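/- Fix 1 ≤ l ≤ D and let s_{n,l−1}, s_{n,l} be the observed suffixes of lengths l−1 and l. For every T ∈ 𝒯(D) with s_{n,l−1} ∈ ℒ(T), Σ_{T′ ∈ 𝒯_{s_{n,l};T}} π_D(T′) Π_{s∈ℒ(T′)} p^e_{n,s} = π_D(T) (Π_{s∈ℒ(T)} p^e_{n,s}) · (1−λ) · λ^{−𝟙[l=D]} · (p^e_{n,s_{n,l}} / p^e_{n,s_{n,l−1}}) · Π_{q∈𝒜 : q s_{n,l−1} ≠ s_{n,l}} p^w_{n,q s_{n,l−1}}, where 𝒯_{s_{n,l};T} := {T′ ∈ 𝒯(D) : s_{n,l} ∈ ℒ(T′) and ℒ(T) ⊆ ℒ(T′) ∪ {s_{n,l−1}}} and 𝟙[l=D] is 1 if l = D and 0 otherwise. -/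

import Mathlib

open scoped Classical

noncomputable section

variable {𝒜 : Type*}

/-- The finset of all strings over `𝒜` of length at most `D`. -/
def stringsLe (𝒜 : Type*) [Fintype 𝒜] (D : ℕ) : Finset (List 𝒜) :=
  Set.Finite.toFinset (List.finite_length_le 𝒜 D)

/-- A context tree of maximum depth `D`, identified with its leaf set: every leaf has length
at most `D`, no leaf is a (proper) suffix of another, and every string of length `D` has
exactly one suffix among the leaves. -/
def IsContextTree (D : ℕ) (T : Finset (List 𝒜)) : Prop :=
  (∀ s ∈ T, s.length ≤ D) ∧
  (∀ s ∈ T, ∀ t ∈ T, s <:+ t → s = t) ∧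
  (∀ w : List 𝒜, w.length = D → ∃! s, s ∈ T ∧ s <:+ w)

/-- The finset of all context trees of maximum depth `D`. -/
def contextTrees (𝒜 : Type*) [Fintype 𝒜] (D : ℕ) : Finset (Finset (List 𝒜)) :=
  (stringsLe 𝒜 D).powerset.filter (IsContextTree D)

/-- The branching-process prior `π_D` on context trees. -/
def priorD [Fintype 𝒜] (lam : ℝ) (D : ℕ) (T : Finset (List 𝒜)) : ℝ :=
  (1 - lam) ^ ((T.card - 1) / (Fintype.card 𝒜 - 1)) *
    lam ^ (T.card - (T.filter (fun s => s.length = D)).card)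

/-- The window `(x_{1-D}, …, x_{j-1})`. -/
def window (x : ℤ → 𝒜) (D : ℕ) (j : ℕ) : List 𝒜 :=
  (List.range (D + j - 1)).map (fun i => x (1 - (D : ℤ) + (i : ℤ)))

/-- The counting vector `𝐧_{n,s}(a)`. -/
def cnt [DecidableEq 𝒜] (x : ℤ → 𝒜) (D n : ℕ) (s : List 𝒜) (a : 𝒜) : ℕ :=
  ((Finset.Icc 1 n).filter (fun (j : ℕ) => x (j : ℤ) = a ∧ s <:+ window x D j)).card

/-- The evidence value `P^e(m)` of a counting vector `m` under Dirichlet parameters `α`. -/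
def pEv [Fintype 𝒜] (α : 𝒜 → ℝ) (m : 𝒜 → ℕ) : ℝ :=
  (Real.Gamma (∑ a, α a) / Real.Gamma (∑ a, ((m a : ℝ) + α a))) *
    ∏ a, (Real.Gamma ((m a : ℝ) + α a) / Real.Gamma (α a))

/-- The evidence `p^e_{n,s}`. -/
def pE [Fintype 𝒜] [DecidableEq 𝒜] (α : 𝒜 → ℝ) (x : ℤ → 𝒜) (D n : ℕ) (s : List 𝒜) : ℝ :=
  pEv α (cnt x D n s)

/-- Auxiliary downward recursion for the CTW weighted probabilities, with fuel `k = D - |s|`. -/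
def pWaux [Fintype 𝒜] [DecidableEq 𝒜] (α : 𝒜 → ℝ) (lam : ℝ) (x : ℤ → 𝒜) (D n : ℕ) :
    ℕ → List 𝒜 → ℝ
  | 0, s => pE α x D n s
  | k + 1, s => lam * pE α x D n s + (1 - lam) * ∏ q, pWaux α lam x D n k (q :: s)

/-- The CTW weighted probability `p^w_{n,s}`. -/
def pW [Fintype 𝒜] [DecidableEq 𝒜] (α : 𝒜 → ℝ) (lam : ℝ) (x : ℤ → 𝒜) (D n : ℕ)
    (s : List 𝒜) : ℝ :=
  pWaux α lam x D n (D - s.length) s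

/-- The observed suffix `s_{n,l} = (x_{n-l+1}, …, x_n)` of length `l`. -/
def sfx (x : ℤ → 𝒜) (n : ℤ) (l : ℕ) : List 𝒜 :=
  (List.range l).map (fun i => x (n - (l : ℤ) + 1 + (i : ℤ)))

/-- The CTW mixture weight `ω_{n,l}`. -/
def omegaW [Fintype 𝒜] [DecidableEq 𝒜] (α : 𝒜 → ℝ) (lam : ℝ) (x : ℤ → 𝒜) (D n l : ℕ) : ℝ :=
  (∑ T ∈ (contextTrees 𝒜 D).filter (fun T => sfx x n l ∈ T),
      priorD lam D T * ∏ s ∈ T, pE α x D n s) / pW α lam x D n []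

/-- The per-suffix Bayesian predictor `p̄_{n,s}(a)`. -/
def pBar [Fintype 𝒜] [DecidableEq 𝒜] (α : 𝒜 → ℝ) (x : ℤ → 𝒜) (D n : ℕ) (s : List 𝒜)
    (a : 𝒜) : ℝ :=
  (α a + cnt x D n s a) / ∑ q, (α q + cnt x D n s q)

end

/-- `U` is the leaf set of a tree of height at most `k` rooted at the string `s`. -/
def IsTreeAt {𝒜 : Type*} (k : ℕ) (s : List 𝒜) (U : Finset (List 𝒜)) : Prop :=
  (∀ t ∈ U, s <:+ t ∧ t.length ≤ s.length + k) ∧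
  (∀ t ∈ U, ∀ t' ∈ U, t <:+ t' → t = t') ∧
  (∀ w : List 𝒜, w.length = s.length + k → s <:+ w → ∃ t ∈ U, t <:+ w)

/-- The finset of all trees of height at most `k` rooted at the string `s`. -/
def treesAt {𝒜 : Type*} [Fintype 𝒜] [DecidableEq 𝒜] :
    ℕ → List 𝒜 → Finset (Finset (List 𝒜))
  | 0, s => {{s}}
  | k + 1, s => {{s}} ∪
      (Fintype.piFinset fun q => treesAt k (q :: s)).image fun f => Finset.univ.biUnion f

/-- The number of internal nodes of a full `|𝒜|`-ary tree with leaf set `U`. -/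
def branchings {𝒜 : Type*} [Fintype 𝒜] (U : Finset (List 𝒜)) : ℕ :=
  (U.card - 1) / (Fintype.card 𝒜 - 1)

/-- The weight of a tree in which each internal node contributes `c` and each leaf `t`
contributes `g t`. -/
noncomputable def treeWeight {𝒜 : Type*} [Fintype 𝒜] (c : ℝ) (g : List 𝒜 → ℝ)
    (U : Finset (List 𝒜)) : ℝ :=
  c ^ branchings U * ∏ t ∈ U, g t

/-- The contribution of a leaf to the prior times the likelihood. -/
noncomputable def leafWeight {𝒜 : Type*} [Fintype 𝒜] [DecidableEq 𝒜] (α : 𝒜 → ℝ) (lam : ℝ)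
    (x : ℤ → 𝒜) (D n : ℕ) (s : List 𝒜) : ℝ :=
  (if s.length = D then 1 else lam) * pE α x D n s

section Strings

variable {𝒜 : Type*}

theorem exists_cons_suffix_of_suffix_of_ne {s t : List 𝒜} (h : s <:+ t) (hne : s ≠ t) :
    ∃ q, q :: s <:+ t := by
  obtain ⟨p, rfl⟩ := h
  rcases List.eq_nil_or_concat p with rfl | ⟨p', q, rfl⟩
  · simp at hne
  · exact ⟨q, p', by simp⟩

theorem head_eq_of_cons_suffix {q q' : 𝒜} {s t : List 𝒜} (h : q :: s <:+ t)
    (h' : q' :: s <:+ t) : q = q' := by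
  have := (List.suffix_of_suffix_length_le h h' (by simp)).eq_of_length (by simp)
  simpa using this

theorem exists_suffix_extension [Nonempty 𝒜] {t : List 𝒜} {D : ℕ} (h : t.length ≤ D) :
    ∃ w : List 𝒜, w.length = D ∧ t <:+ w :=
  ⟨List.replicate (D - t.length) (Classical.arbitrary 𝒜) ++ t, by simp; omega,
    List.suffix_append _ _⟩

theorem length_sfx (x : ℤ → 𝒜) (n : ℤ) (l : ℕ) : (sfx x n l).length = l := by
  simp [sfx]

theorem sfx_succ (x : ℤ → 𝒜) (n : ℤ) (l : ℕ) :
    sfx x n (l + 1) = x (n - l) :: sfx x n l := by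
  simp [sfx, List.range_succ_eq_map, List.flatMap_map, List.map_flatMap, sub_add_eq_sub_sub,
    add_assoc, add_comm (1 : ℤ)]

theorem IsTreeAt.eq_singleton_of_root_mem {k : ℕ} {s : List 𝒜} {U : Finset (List 𝒜)}
    (hU : IsTreeAt k s U) (hs : s ∈ U) : U = {s} :=
  Finset.eq_singleton_iff_unique_mem.2
    ⟨hs, fun t ht => (hU.2.1 s hs t ht (hU.1 t ht).1).symm⟩

theorem isTreeAt_singleton (k : ℕ) (s : List 𝒜) : IsTreeAt k s {s} := by
  refine ⟨?_, ?_, ?_⟩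
  · simp
  · simp
  · intro w _ h
    exact ⟨s, by simp, h⟩

end Strings

section ContextTrees

variable {𝒜 : Type*} [DecidableEq 𝒜]

theorem IsTreeAt.filter_cons_suffix {k : ℕ} {s : List 𝒜} {U : Finset (List 𝒜)}
    (hU : IsTreeAt (k + 1) s U) (hs : s ∉ U) (q : 𝒜) :
    IsTreeAt k (q :: s) (U.filter fun t => q :: s <:+ t) := by
  refine ⟨?_, ?_, ?_⟩
  · intro t ht
    obtain ⟨ht, h⟩ := Finset.mem_filter.1 ht
    have := (hU.1 t ht).2
    refine ⟨h, ?_⟩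
    simp only [List.length_cons]
    omega
  · intro t ht t' ht'
    exact hU.2.1 t (Finset.mem_filter.1 ht).1 t' (Finset.mem_filter.1 ht').1
  · intro w hw h
    obtain ⟨t, ht, htw⟩ := hU.2.2 w (by simp only [List.length_cons] at hw; omega)
      ((List.suffix_cons q s).trans h)
    obtain ⟨q', hq'⟩ := exists_cons_suffix_of_suffix_of_ne (hU.1 t ht).1
      (by rintro rfl; exact hs ht)
    obtain rfl := head_eq_of_cons_suffix (hq'.trans htw) h
    exact ⟨t, Finset.mem_filter.2 ⟨ht, hq'⟩, htw⟩

theorem IsContextTree.not_suffix_of_mem_erase {D : ℕ} {s t : List 𝒜} {T : Finset (List 𝒜)}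
    (hT : IsContextTree D T) (hs : s ∈ T) (ht : t ∈ T.erase s) : ¬ s <:+ t := fun h =>
  Finset.ne_of_mem_erase ht (hT.2.1 s hs t (Finset.mem_of_mem_erase ht) h).symm

theorem IsContextTree.not_suffix_of_mem_erase' {D : ℕ} {s t : List 𝒜} {T : Finset (List 𝒜)}
    (hT : IsContextTree D T) (hs : s ∈ T) (ht : t ∈ T.erase s) : ¬ t <:+ s := fun h =>
  Finset.ne_of_mem_erase ht (hT.2.1 t (Finset.mem_of_mem_erase ht) s hs h)

/-- Replacing a leaf of a context tree by a tree rooted at it gives a context tree. -/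
theorem IsContextTree.erase_union {D k : ℕ} {s : List 𝒜} {T V : Finset (List 𝒜)}
    (hT : IsContextTree D T) (hs : s ∈ T) (hk : s.length + k = D) (hV : IsTreeAt k s V) :
    IsContextTree D (T.erase s ∪ V) := by
  have hanti : ∀ t ∈ T.erase s ∪ V, ∀ t' ∈ T.erase s ∪ V, t <:+ t' → t = t' := by
    intro t ht t' ht' h
    rcases Finset.mem_union.1 ht with ht | ht <;> rcases Finset.mem_union.1 ht' with ht' | ht'
    · exact hT.2.1 t (Finset.mem_of_mem_erase ht) t' (Finset.mem_of_mem_erase ht') h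
    · rcases List.suffix_or_suffix_of_suffix h (hV.1 t' ht').1 with h' | h'
      · exact absurd h' (hT.not_suffix_of_mem_erase' hs ht)
      · exact absurd h' (hT.not_suffix_of_mem_erase hs ht)
    · exact absurd ((hV.1 t ht).1.trans h) (hT.not_suffix_of_mem_erase hs ht')
    · exact hV.2.1 t ht t' ht' h
  refine ⟨?_, hanti, ?_⟩
  · intro t ht
    rcases Finset.mem_union.1 ht with ht | ht
    · exact hT.1 t (Finset.mem_of_mem_erase ht)
    · exact hk ▸ (hV.1 t ht).2
  · intro w hw
    refine existsUnique_of_exists_of_unique ?_ ?_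
    · obtain ⟨t, ⟨ht, htw⟩, -⟩ := hT.2.2 w hw
      by_cases hts : t = s
      · subst hts
        obtain ⟨u, hu, huw⟩ := hV.2.2 w (by omega) htw
        exact ⟨u, Finset.mem_union_right _ hu, huw⟩
      · exact ⟨t, Finset.mem_union_left _ (Finset.mem_erase.2 ⟨hts, ht⟩), htw⟩
    · rintro t t' ⟨ht, htw⟩ ⟨ht', htw'⟩
      rcases List.suffix_or_suffix_of_suffix htw htw' with h | h
      · exact hanti t ht t' ht' h
      · exact (hanti t' ht' t ht h).symm

/-- The part of a context tree below a string that is a suffix of one of its leaves. -/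
theorem IsContextTree.isTreeAt_filter {D k : ℕ} {s u : List 𝒜} {T : Finset (List 𝒜)}
    (hT : IsContextTree D T) (hu : u ∈ T) (hsu : s <:+ u) (hk : s.length + k = D) :
    IsTreeAt k s (T.filter fun t => s <:+ t) := by
  refine ⟨?_, ?_, ?_⟩
  · intro t ht
    obtain ⟨ht, h⟩ := Finset.mem_filter.1 ht
    exact ⟨h, hk ▸ hT.1 t ht⟩
  · intro t ht t' ht'
    exact hT.2.1 t (Finset.mem_filter.1 ht).1 t' (Finset.mem_filter.1 ht').1
  · intro w hw h
    obtain ⟨t, ⟨ht, htw⟩, -⟩ := hT.2.2 w (by omega)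
    refine ⟨t, Finset.mem_filter.2 ⟨ht, ?_⟩, htw⟩
    rcases List.suffix_or_suffix_of_suffix h htw with h' | h'
    · exact h'
    · rw [hT.2.1 t ht u hu (h'.trans hsu)]
      exact hsu

theorem IsContextTree.erase_union_filter_eq [Nonempty 𝒜] {D : ℕ} {s u : List 𝒜}
    {T T' : Finset (List 𝒜)} (hT : IsContextTree D T) (hT' : IsContextTree D T')
    (hu : u ∈ T') (hsu : s <:+ u) (hsub : T ⊆ T' ∪ {s}) :
    T.erase s ∪ T'.filter (fun t => s <:+ t) = T' := by
  have herase : T.erase s ⊆ T' := fun t ht => by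
    have := hsub (Finset.mem_of_mem_erase ht)
    simpa [Finset.ne_of_mem_erase ht] using this
  refine Finset.Subset.antisymm (Finset.union_subset herase (Finset.filter_subset _ _)) ?_
  intro t ht
  by_cases hst : s <:+ t
  · exact Finset.mem_union_right _ (Finset.mem_filter.2 ⟨ht, hst⟩)
  refine Finset.mem_union_left _ ?_
  obtain ⟨w, hw, htw⟩ := exists_suffix_extension (hT'.1 t ht)
  obtain ⟨v, ⟨hv, hvw⟩, -⟩ := hT.2.2 w hw
  have hvs : v ≠ s := by
    rintro rfl
    rcases List.suffix_or_suffix_of_suffix htw hvw with h | h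
    · exact hst (hT'.2.1 t ht u hu (h.trans hsu) ▸ hsu)
    · exact hst h
  have hv' : v ∈ T.erase s := Finset.mem_erase.2 ⟨hvs, hv⟩
  rwa [(hT'.2.2 w hw).unique ⟨ht, htw⟩ ⟨herase hv', hvw⟩]

theorem filter_suffix_erase_union {D k : ℕ} {s : List 𝒜} {T V : Finset (List 𝒜)}
    (hT : IsContextTree D T) (hs : s ∈ T) (hV : IsTreeAt k s V) :
    (T.erase s ∪ V).filter (fun t => s <:+ t) = V := by
  rw [Finset.filter_union,
    Finset.filter_false_of_mem fun t ht => hT.not_suffix_of_mem_erase hs ht,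
    Finset.filter_true_of_mem fun t ht => (hV.1 t ht).1, Finset.empty_union]

end ContextTrees

section Leaves

variable {𝒜 : Type*} [Fintype 𝒜]

theorem pairwiseDisjoint_of_cons_suffix {s : List 𝒜} {f : 𝒜 → Finset (List 𝒜)}
    (hf : ∀ q, ∀ t ∈ f q, q :: s <:+ t) :
    Set.PairwiseDisjoint (↑(Finset.univ : Finset 𝒜)) f := by
  intro q _ q' _ hne
  refine Finset.disjoint_left.2 fun t h h' => hne ?_
  exact head_eq_of_cons_suffix (hf q t h) (hf q' t h')

theorem branchings_eq_of_card_eq (hA : 2 ≤ Fintype.card 𝒜) {U : Finset (List 𝒜)} {m : ℕ}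
    (h : U.card = m * (Fintype.card 𝒜 - 1) + 1) : branchings U = m := by
  rw [branchings, h, Nat.add_sub_cancel, Nat.mul_div_cancel _ (by omega)]

theorem treeWeight_singleton (c : ℝ) (g : List 𝒜 → ℝ) (s : List 𝒜) :
    treeWeight c g {s} = g s := by
  simp [treeWeight, branchings]

theorem mem_contextTrees {D : ℕ} {T : Finset (List 𝒜)} :
    T ∈ contextTrees 𝒜 D ↔ IsContextTree D T := by
  simp only [contextTrees, stringsLe, Finset.mem_filter, Finset.mem_powerset,
    and_iff_right_iff_imp]
  exact fun h t ht => by simpa using h.1 t ht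

end Leaves

section Trees

variable {𝒜 : Type*} [Fintype 𝒜] [DecidableEq 𝒜]

theorem filter_biUnion_eq_of_cons_suffix {s : List 𝒜} {f : 𝒜 → Finset (List 𝒜)}
    (hf : ∀ q, ∀ t ∈ f q, q :: s <:+ t) (q : 𝒜) :
    (Finset.univ.biUnion f).filter (fun t => q :: s <:+ t) = f q := by
  ext t
  simp only [Finset.mem_filter, Finset.mem_biUnion, Finset.mem_univ, true_and]
  constructor
  · rintro ⟨⟨q', ht⟩, h⟩
    rwa [head_eq_of_cons_suffix h (hf q' t ht)]
  · exact fun h => ⟨⟨q, h⟩, hf q t h⟩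

theorem isTreeAt_biUnion {k : ℕ} {s : List 𝒜} {f : 𝒜 → Finset (List 𝒜)}
    (hf : ∀ q, IsTreeAt k (q :: s) (f q)) : IsTreeAt (k + 1) s (Finset.univ.biUnion f) := by
  refine ⟨?_, ?_, ?_⟩
  · intro t ht
    obtain ⟨q, -, ht⟩ := Finset.mem_biUnion.1 ht
    obtain ⟨h1, h2⟩ := (hf q).1 t ht
    refine ⟨(List.suffix_cons q s).trans h1, ?_⟩
    simp only [List.length_cons] at h2
    omega
  · intro t ht t' ht' h
    obtain ⟨q, -, ht⟩ := Finset.mem_biUnion.1 ht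
    obtain ⟨q', -, ht'⟩ := Finset.mem_biUnion.1 ht'
    obtain rfl := head_eq_of_cons_suffix (((hf q).1 t ht).1.trans h) ((hf q').1 t' ht').1
    exact (hf q).2.1 t ht t' ht' h
  · intro w hw h
    obtain ⟨q, hq⟩ := exists_cons_suffix_of_suffix_of_ne h (by rintro rfl; omega)
    obtain ⟨t, ht, htw⟩ := (hf q).2.2 w (by simp only [List.length_cons]; omega) hq
    exact ⟨t, Finset.mem_biUnion.2 ⟨q, Finset.mem_univ q, ht⟩, htw⟩

theorem IsTreeAt.biUnion_filter_cons_suffix {k : ℕ} {s : List 𝒜} {U : Finset (List 𝒜)}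
    (hU : IsTreeAt k s U) (hs : s ∉ U) :
    Finset.univ.biUnion (fun q => U.filter fun t => q :: s <:+ t) = U := by
  ext t
  simp only [Finset.mem_biUnion, Finset.mem_univ, true_and, Finset.mem_filter]
  constructor
  · rintro ⟨_, h, _⟩
    exact h
  · intro ht
    obtain ⟨q, hq⟩ := exists_cons_suffix_of_suffix_of_ne (hU.1 t ht).1
      (by rintro rfl; exact hs ht)
    exact ⟨q, ht, hq⟩

theorem mem_treesAt {k : ℕ} {s : List 𝒜} {U : Finset (List 𝒜)} :
    U ∈ treesAt k s ↔ IsTreeAt k s U := by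
  induction k generalizing s U with
  | zero =>
    simp only [treesAt, Finset.mem_singleton]
    constructor
    · rintro rfl
      exact isTreeAt_singleton 0 s
    · intro hU
      obtain ⟨t, ht, hts⟩ := hU.2.2 s rfl List.suffix_rfl
      obtain rfl := hts.eq_of_length_le (hU.1 t ht).1.length_le
      exact hU.eq_singleton_of_root_mem ht
  | succ k ih =>
    simp only [treesAt, Finset.mem_union, Finset.mem_singleton, Finset.mem_image,
      Fintype.mem_piFinset, ih]
    constructor
    · rintro (rfl | ⟨f, hf, rfl⟩)
      · exact isTreeAt_singleton _ s
      · exact isTreeAt_biUnion hf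
    · intro hU
      by_cases hs : s ∈ U
      · exact Or.inl (hU.eq_singleton_of_root_mem hs)
      · exact Or.inr ⟨_, hU.filter_cons_suffix hs, hU.biUnion_filter_cons_suffix hs⟩

theorem cons_suffix_of_mem_piFinset {k : ℕ} {s : List 𝒜} {f : 𝒜 → Finset (List 𝒜)}
    (hf : f ∈ Fintype.piFinset fun q => treesAt k (q :: s)) (q : 𝒜) (t : List 𝒜)
    (ht : t ∈ f q) : q :: s <:+ t :=
  ((mem_treesAt.1 (Fintype.mem_piFinset.1 hf q)).1 t ht).1

theorem injOn_biUnion_piFinset_treesAt (k : ℕ) (s : List 𝒜) :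
    Set.InjOn (fun f : 𝒜 → Finset (List 𝒜) => Finset.univ.biUnion f)
      (Fintype.piFinset fun q => treesAt k (q :: s)) := by
  intro f hf f' hf' h
  funext q
  rw [← filter_biUnion_eq_of_cons_suffix (cons_suffix_of_mem_piFinset hf) q,
    ← filter_biUnion_eq_of_cons_suffix (cons_suffix_of_mem_piFinset hf') q]
  exact congrArg _ h

theorem card_biUnion_eq_sum_branchings {s : List 𝒜} (hA : 2 ≤ Fintype.card 𝒜)
    {f : 𝒜 → Finset (List 𝒜)} (hf : ∀ q, ∀ t ∈ f q, q :: s <:+ t)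
    (hcard : ∀ q, (f q).card = branchings (f q) * (Fintype.card 𝒜 - 1) + 1) :
    (Finset.univ.biUnion f).card
      = (∑ q, branchings (f q) + 1) * (Fintype.card 𝒜 - 1) + 1 := by
  rw [Finset.card_biUnion (pairwiseDisjoint_of_cons_suffix hf),
    Finset.sum_congr rfl fun q _ => hcard q, Finset.sum_add_distrib, ← Finset.sum_mul]
  simp only [Finset.sum_const, Finset.card_univ, smul_eq_mul, mul_one, add_mul, one_mul]
  omega

theorem card_of_mem_treesAt (hA : 2 ≤ Fintype.card 𝒜) {k : ℕ} {s : List 𝒜}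
    {U : Finset (List 𝒜)} (hU : U ∈ treesAt k s) :
    U.card = branchings U * (Fintype.card 𝒜 - 1) + 1 := by
  induction k generalizing s U with
  | zero =>
    obtain rfl := Finset.mem_singleton.1 hU
    simp [branchings]
  | succ k ih =>
    rcases Finset.mem_union.1 hU with h | h
    · obtain rfl := Finset.mem_singleton.1 h
      simp [branchings]
    · obtain ⟨f, hf, rfl⟩ := Finset.mem_image.1 h
      have h := card_biUnion_eq_sum_branchings hA (cons_suffix_of_mem_piFinset hf)
        fun q => ih (Fintype.mem_piFinset.1 hf q)
      rwa [branchings_eq_of_card_eq hA h]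

theorem treeWeight_biUnion (hA : 2 ≤ Fintype.card 𝒜) (c : ℝ) (g : List 𝒜 → ℝ) {k : ℕ}
    {s : List 𝒜} {f : 𝒜 → Finset (List 𝒜)}
    (hf : f ∈ Fintype.piFinset fun q => treesAt k (q :: s)) :
    treeWeight c g (Finset.univ.biUnion f) = c * ∏ q, treeWeight c g (f q) := by
  have hsuf := cons_suffix_of_mem_piFinset hf
  have h := card_biUnion_eq_sum_branchings hA hsuf
    fun q => card_of_mem_treesAt hA (Fintype.mem_piFinset.1 hf q)
  simp only [treeWeight]
  rw [branchings_eq_of_card_eq hA h, Finset.prod_biUnion (pairwiseDisjoint_of_cons_suffix hsuf),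
    Finset.prod_mul_distrib, Finset.prod_pow_eq_pow_sum, pow_succ]
  ring

/-- Summation of weights over trees assembled from independently chosen subtrees. -/
theorem sum_image_biUnion_treeWeight (hA : 2 ≤ Fintype.card 𝒜) (c : ℝ) (g : List 𝒜 → ℝ)
    {k : ℕ} {s : List 𝒜} {𝒰 : 𝒜 → Finset (Finset (List 𝒜))}
    (h𝒰 : ∀ q, 𝒰 q ⊆ treesAt k (q :: s)) :
    ∑ U ∈ (Fintype.piFinset 𝒰).image (fun f => Finset.univ.biUnion f), treeWeight c g U
      = c * ∏ q, ∑ U ∈ 𝒰 q, treeWeight c g U := by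
  have hsub := Fintype.piFinset_subset _ _ h𝒰
  rw [Finset.sum_image ((injOn_biUnion_piFinset_treesAt k s).mono (Finset.coe_subset.2 hsub)),
    Finset.prod_univ_sum, Finset.mul_sum]
  exact Finset.sum_congr rfl fun f hf => treeWeight_biUnion hA c g (hsub hf)

theorem sum_treesAt_succ (hA : 2 ≤ Fintype.card 𝒜) (c : ℝ) (g : List 𝒜 → ℝ) (k : ℕ)
    (s : List 𝒜) :
    ∑ U ∈ treesAt (k + 1) s, treeWeight c g U
      = g s + c * ∏ q, ∑ U ∈ treesAt k (q :: s), treeWeight c g U := by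
  rw [treesAt, Finset.sum_union, Finset.sum_singleton, treeWeight_singleton,
    sum_image_biUnion_treeWeight hA c g fun _ => subset_rfl]
  refine Finset.disjoint_singleton_left.2 fun h => ?_
  obtain ⟨f, hf, hfs⟩ := Finset.mem_image.1 h
  have hs : s ∈ Finset.univ.biUnion f := by rw [hfs]; simp
  obtain ⟨q, -, hq⟩ := Finset.mem_biUnion.1 hs
  simpa using (cons_suffix_of_mem_piFinset hf q s hq).length_le

/-- The trees rooted at `s` having the child `q₀ :: s` as a leaf. -/
theorem filter_child_mem_treesAt_succ (k : ℕ) (s : List 𝒜) (q₀ : 𝒜) :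
    (treesAt (k + 1) s).filter (fun U => q₀ :: s ∈ U)
      = (Fintype.piFinset fun q => if q = q₀ then {{q :: s}} else treesAt k (q :: s)).image
          fun f => Finset.univ.biUnion f := by
  ext U
  simp only [Finset.mem_filter, treesAt, Finset.mem_union, Finset.mem_singleton,
    Finset.mem_image]
  constructor
  · rintro ⟨rfl | ⟨f, hf, rfl⟩, h⟩
    · simp at h
    · refine ⟨f, Fintype.mem_piFinset.2 fun q => ?_, rfl⟩
      split_ifs with hq
      · subst hq
        obtain ⟨q', -, hq'⟩ := Finset.mem_biUnion.1 h
        obtain rfl := head_eq_of_cons_suffix (cons_suffix_of_mem_piFinset hf q' _ hq')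
          List.suffix_rfl
        exact Finset.mem_singleton.2
          ((mem_treesAt.1 (Fintype.mem_piFinset.1 hf q')).eq_singleton_of_root_mem hq')
      · exact Fintype.mem_piFinset.1 hf q
  · rintro ⟨f, hf, rfl⟩
    rw [Fintype.mem_piFinset] at hf
    refine ⟨Or.inr ⟨f, Fintype.mem_piFinset.2 fun q => ?_, rfl⟩, ?_⟩
    · have := hf q
      split_ifs at this
      · rw [Finset.mem_singleton.1 this]
        exact mem_treesAt.2 (isTreeAt_singleton k _)
      · exact this
    · have := hf q₀
      rw [if_pos rfl, Finset.mem_singleton] at this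
      exact Finset.mem_biUnion.2 ⟨q₀, Finset.mem_univ _, by simp [this]⟩

theorem sum_filter_child_mem_treesAt_succ (hA : 2 ≤ Fintype.card 𝒜) (c : ℝ)
    (g : List 𝒜 → ℝ) (k : ℕ) (s : List 𝒜) (q₀ : 𝒜) :
    ∑ U ∈ (treesAt (k + 1) s).filter (fun U => q₀ :: s ∈ U), treeWeight c g U
      = c * (g (q₀ :: s) * ∏ q ∈ Finset.univ.filter (fun q => q ≠ q₀),
          ∑ U ∈ treesAt k (q :: s), treeWeight c g U) := by
  rw [filter_child_mem_treesAt_succ, sum_image_biUnion_treeWeight (k := k) (s := s) hA c g]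
  · rw [← Finset.mul_prod_erase _ _ (Finset.mem_univ q₀), if_pos rfl, Finset.sum_singleton,
      treeWeight_singleton, Finset.filter_ne']
    congr 2
    refine Finset.prod_congr rfl fun q hq => ?_
    rw [if_neg (Finset.ne_of_mem_erase hq)]
  · intro q
    split_ifs
    · exact Finset.singleton_subset_iff.2 (mem_treesAt.2 (isTreeAt_singleton k _))
    · exact subset_rfl

theorem treeWeight_erase_union (hA : 2 ≤ Fintype.card 𝒜) (c : ℝ) (g : List 𝒜 → ℝ) {k : ℕ}
    {s : List 𝒜} {T V : Finset (List 𝒜)} (hs : s ∈ T) (hV : V ∈ treesAt k s)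
    (hdisj : Disjoint (T.erase s) V) (hg : g s ≠ 0) :
    treeWeight c g (T.erase s ∪ V) = treeWeight c g T / g s * treeWeight c g V := by
  have hcard : branchings (T.erase s ∪ V) = branchings T + branchings V := by
    have hpos : 0 < T.card := Finset.card_pos.2 ⟨s, hs⟩
    rw [branchings, Finset.card_union_of_disjoint hdisj, Finset.card_erase_of_mem hs,
      card_of_mem_treesAt hA hV, ← Nat.add_assoc, Nat.add_sub_cancel,
      Nat.add_mul_div_right _ _ (by omega), ← branchings]
  rw [treeWeight, hcard, Finset.prod_union hdisj, treeWeight, treeWeight,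
    ← Finset.mul_prod_erase T g hs, pow_add]
  field_simp

/-- The context trees having the child `q₀ :: s` as a leaf and agreeing with `T` away from its
leaf `s` are obtained by replacing `s` with a tree rooted at it. -/
theorem fiber_eq_image [Nonempty 𝒜] {D k : ℕ} {s : List 𝒜} {q₀ : 𝒜} {T : Finset (List 𝒜)}
    (hT : IsContextTree D T) (hs : s ∈ T) (hk : s.length + k = D) :
    (contextTrees 𝒜 D).filter (fun T' => q₀ :: s ∈ T' ∧ T ⊆ T' ∪ {s})
      = ((treesAt k s).filter fun V => q₀ :: s ∈ V).image fun V => T.erase s ∪ V := by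
  ext T'
  simp only [Finset.mem_filter, Finset.mem_image, mem_contextTrees, mem_treesAt]
  have hsu : s <:+ q₀ :: s := List.suffix_cons q₀ s
  constructor
  · rintro ⟨hT', hu, hsub⟩
    exact ⟨_, ⟨hT'.isTreeAt_filter hu hsu hk, Finset.mem_filter.2 ⟨hu, hsu⟩⟩,
      hT.erase_union_filter_eq hT' hu hsu hsub⟩
  · rintro ⟨V, ⟨hV, hu⟩, rfl⟩
    refine ⟨hT.erase_union hs hk hV, Finset.mem_union_right _ hu, fun t ht => ?_⟩
    by_cases hts : t = s <;> simp [hts, ht]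

theorem sum_fiber_treeWeight (hA : 2 ≤ Fintype.card 𝒜) (c : ℝ) (g : List 𝒜 → ℝ) {D k : ℕ}
    {s : List 𝒜} (q₀ : 𝒜) {T : Finset (List 𝒜)} (hT : IsContextTree D T) (hs : s ∈ T)
    (hk : s.length + (k + 1) = D) (hg : g s ≠ 0) :
    ∑ T' ∈ (contextTrees 𝒜 D).filter (fun T' => q₀ :: s ∈ T' ∧ T ⊆ T' ∪ {s}),
        treeWeight c g T'
      = treeWeight c g T / g s * (c * (g (q₀ :: s) *
          ∏ q ∈ Finset.univ.filter (fun q => q ≠ q₀),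
            ∑ U ∈ treesAt k (q :: s), treeWeight c g U)) := by
  have : Nonempty 𝒜 := ⟨q₀⟩
  rw [fiber_eq_image hT hs hk, Finset.sum_image, ← sum_filter_child_mem_treesAt_succ hA,
    Finset.mul_sum]
  · refine Finset.sum_congr rfl fun V hV => ?_
    have hV := (Finset.mem_filter.1 hV).1
    refine treeWeight_erase_union hA c g hs hV (Finset.disjoint_left.2 fun t ht htV => ?_) hg
    exact hT.not_suffix_of_mem_erase hs ht ((mem_treesAt.1 hV).1 t htV).1
  · intro V hV V' hV' h
    rw [← filter_suffix_erase_union hT hs (mem_treesAt.1 (Finset.mem_filter.1 hV).1),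
      ← filter_suffix_erase_union hT hs (mem_treesAt.1 (Finset.mem_filter.1 hV').1)]
    exact congrArg _ h

end Trees

section Evidence

variable {𝒜 : Type*} [Fintype 𝒜] [DecidableEq 𝒜]

theorem pE_pos [Nonempty 𝒜] {α : 𝒜 → ℝ} (hα : ∀ a, 0 < α a) (x : ℤ → 𝒜) (D n : ℕ)
    (s : List 𝒜) : 0 < pE α x D n s := by
  have hm : ∀ a, 0 < (cnt x D n s a : ℝ) + α a := fun a => by have := hα a; positivity
  refine mul_pos (div_pos (Real.Gamma_pos_of_pos ?_) (Real.Gamma_pos_of_pos ?_))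
    (Finset.prod_pos fun a _ =>
      div_pos (Real.Gamma_pos_of_pos (hm a)) (Real.Gamma_pos_of_pos (hα a)))
  · exact Finset.sum_pos (fun a _ => hα a) Finset.univ_nonempty
  · exact Finset.sum_pos (fun a _ => hm a) Finset.univ_nonempty

theorem priorD_mul_prod_pE (α : 𝒜 → ℝ) (lam : ℝ) (x : ℤ → 𝒜) (D n : ℕ)
    (T : Finset (List 𝒜)) :
    priorD lam D T * ∏ s ∈ T, pE α x D n s
      = treeWeight (1 - lam) (leafWeight α lam x D n) T := by
  have hcard : (T.filter fun s => ¬ s.length = D).card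
      = T.card - (T.filter fun s => s.length = D).card := by
    have := Finset.card_filter_add_card_filter_not (s := T) (fun s : List 𝒜 => s.length = D)
    omega
  simp only [treeWeight, leafWeight]
  rw [Finset.prod_mul_distrib, Finset.prod_ite, Finset.prod_const_one, one_mul,
    Finset.prod_const, hcard, priorD, branchings, mul_assoc]

theorem sum_treesAt_eq_pWaux (hA : 2 ≤ Fintype.card 𝒜) (α : 𝒜 → ℝ) (lam : ℝ) (x : ℤ → 𝒜)
    (D n k : ℕ) (s : List 𝒜) (hk : s.length + k = D) :
    ∑ U ∈ treesAt k s, treeWeight (1 - lam) (leafWeight α lam x D n) U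
      = pWaux α lam x D n k s := by
  induction k generalizing s with
  | zero =>
    rw [treesAt, Finset.sum_singleton, treeWeight_singleton, leafWeight, if_pos (by omega),
      one_mul, pWaux]
  | succ k ih =>
    rw [sum_treesAt_succ hA, pWaux, leafWeight, if_neg (by omega),
      Finset.prod_congr rfl fun q _ => ih (q :: s) (by simp only [List.length_cons]; omega)]

end Evidence

/-- Summing the weighted likelihoods over the fiber
`𝒯_{s_{n,l};T} = {T' ∈ 𝒯(D) : s_{n,l} ∈ ℒ(T') ∧ ℒ(T) ⊆ ℒ(T') ∪ {s_{n,l-1}}}` of a tree `T`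
with leaf `s_{n,l-1}` produces the closed-form product involving the evidences and the CTW
weighted probabilities of the siblings. -/
theorem fiber_sum_formula {𝒜 : Type*} [Fintype 𝒜] [DecidableEq 𝒜]
    (hA : 2 ≤ Fintype.card 𝒜) (D n : ℕ) (hD : 1 ≤ D) (hn : 1 ≤ n)
    (lam : ℝ) (hlam : lam ∈ Set.Ioo (0 : ℝ) 1)
    (α : 𝒜 → ℝ) (hα : ∀ a, 0 < α a) (x : ℤ → 𝒜)
    (l : ℕ) (hl : 1 ≤ l) (hlD : l ≤ D)
    (T : Finset (List 𝒜)) (hT : T ∈ contextTrees 𝒜 D) (hsT : sfx x (n : ℤ) (l - 1) ∈ T) :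
    ∑ T' ∈ (contextTrees 𝒜 D).filter
        (fun T' => sfx x (n : ℤ) l ∈ T' ∧ T ⊆ T' ∪ {sfx x (n : ℤ) (l - 1)}),
        priorD lam D T' * ∏ s ∈ T', pE α x D n s
      = priorD lam D T * (∏ s ∈ T, pE α x D n s) * (1 - lam) * (if l = D then lam⁻¹ else 1) *
          (pE α x D n (sfx x (n : ℤ) l) / pE α x D n (sfx x (n : ℤ) (l - 1))) *
          ∏ q ∈ Finset.univ.filter (fun q => q :: sfx x (n : ℤ) (l - 1) ≠ sfx x (n : ℤ) l),
            pW α lam x D n (q :: sfx x (n : ℤ) (l - 1)) := by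
  have hne : Nonempty 𝒜 := ⟨x 0⟩
  obtain ⟨m, rfl⟩ : ∃ m, l = m + 1 := ⟨l - 1, by omega⟩
  simp only [Nat.add_sub_cancel, sfx_succ] at hsT ⊢
  have hlen : (sfx x n m).length = m := length_sfx x n m
  set s := sfx x (n : ℤ) m
  set q₀ := x ((n : ℤ) - m)
  have hpE : pE α x D n s ≠ 0 := (pE_pos hα x D n s).ne'
  have hlam0 : lam ≠ 0 := hlam.1.ne'
  have hg : leafWeight α lam x D n s = lam * pE α x D n s := by
    rw [leafWeight, if_neg (by omega)]
  have hg' : leafWeight α lam x D n (q₀ :: s)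
      = lam * (if m + 1 = D then lam⁻¹ else 1) * pE α x D n (q₀ :: s) := by
    rw [leafWeight, List.length_cons, hlen]
    split_ifs <;> simp [hlam0]
  have hsum : ∀ q, ∑ U ∈ treesAt (D - (m + 1)) (q :: s),
      treeWeight (1 - lam) (leafWeight α lam x D n) U = pW α lam x D n (q :: s) := fun q => by
    rw [sum_treesAt_eq_pWaux hA α lam x D n _ _ (by rw [List.length_cons]; omega), pW,
      List.length_cons, hlen]
  simp only [priorD_mul_prod_pE, ne_eq, List.cons.injEq, and_true]
  rw [sum_fiber_treeWeight (k := D - (m + 1)) hA _ _ q₀ (mem_contextTrees.1 hT) hsT (by omega)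
    (by rw [hg]; exact mul_ne_zero hlam0 hpE), hg, hg', Finset.prod_congr rfl fun q _ => hsum q]
  field_simp
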